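/- Let ε > 0 and λ ∈ ℝ, and let α₁ < α₂ < 0. Let u_{α₁} and u_{α₂} be solutions of (∗) with u_{α_i}(0) = α_i and u_{α_i}'(0) = 0, both defined on [0, T] where 0 < T ≤ π/2. If u_{α₂}(t) ≤ 0 for all t ∈ [0, T], then u_{α₁}(t) < u_{α₂}(t) for all t ∈ [0, T]. -/

import Mathlib

open Real Set

/-- A function that is nonnegative just to the left of a zero has nonpositive derivative there. -/
theorem HasDerivAt.nonpos_of_nonneg_left {d : ℝ → ℝ} {d' a s : ℝ} (has : a < s)
    (hd : HasDerivAt d d' s) (hs : d s = 0) (hpos : ∀ t ∈ Ioo a s, 0 ≤ d t) : d' ≤ 0 := by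
  have h := (hasDerivWithinAt_iff_tendsto_slope' (s := Iio s) (lt_irrefl s)).1
    hd.hasDerivWithinAt
  refine le_of_tendsto h ?_
  filter_upwards [Ioo_mem_nhdsLT has] with t ht
  rw [slope_def_field, hs, sub_zero]
  exact div_nonpos_of_nonneg_of_nonpos (hpos t ht) (by linarith [ht.2])

/-- If `0 < d a` and `d` is not positive on all of `[a, b]`, then `d` has a first zero there. -/
theorem ContinuousOn.exists_first_zero {d : ℝ → ℝ} {a b r : ℝ} (hd : ContinuousOn d (Icc a b))
    (ha : 0 < d a) (hr : r ∈ Icc a b) (hdr : d r ≤ 0) :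
    ∃ s ∈ Ioc a b, d s = 0 ∧ ∀ t ∈ Ico a s, 0 < d t := by
  have hclosed : IsClosed (Icc a b ∩ d ⁻¹' Iic 0) :=
    hd.preimage_isClosed_of_isClosed isClosed_Icc isClosed_Iic
  obtain ⟨s, ⟨hs, hds⟩, hmin⟩ :=
    (isCompact_Icc.of_isClosed_subset hclosed inter_subset_left).exists_isLeast ⟨r, hr, hdr⟩
  have hbefore : ∀ t ∈ Ico a s, 0 < d t := fun t ht => by
    by_contra! h
    exact (hmin ⟨⟨ht.1, ht.2.le.trans hs.2⟩, h⟩).not_gt ht.2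
  obtain ⟨z, hz, hdz⟩ := intermediate_value_Icc' hs.1
    (hd.mono (Icc_subset_Icc_right hs.2)) ⟨hds, ha.le⟩
  have hzs : z = s := by
    by_contra h
    exact (hbefore z ⟨hz.1, lt_of_le_of_ne hz.2 h⟩).ne' hdz
  subst hzs
  refine ⟨z, ⟨lt_of_le_of_ne hz.1 ?_, hs.2⟩, hdz, hbefore⟩
  rintro rfl
  exact ha.ne' hdz

/-- Comparison lemma: if `α₁ < α₂ < 0`, `u₁, u₂` solve the Duffing equation
`ε²·u'' = u³ − λ·u + cos t` on `[0,T]` with `u_i(0) = α_i`, `u_i'(0) = 0`,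
`0 < T ≤ π/2`, and `u₂ ≤ 0` on `[0,T]`, then `u₁ < u₂` on `[0,T]`. -/
theorem stmt_5 (ε lam α₁ α₂ T : ℝ) (hε : 0 < ε)
    (hα : α₁ < α₂) (hα2 : α₂ < 0) (hT : 0 < T) (hT2 : T ≤ π / 2)
    (u₁ u₂ : ℝ → ℝ) (hu₁ : ContDiff ℝ 2 u₁) (hu₂ : ContDiff ℝ 2 u₂)
    (heq₁ : ∀ t ∈ Icc (0 : ℝ) T,
      ε ^ 2 * deriv (deriv u₁) t = u₁ t ^ 3 - lam * u₁ t + Real.cos t)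
    (heq₂ : ∀ t ∈ Icc (0 : ℝ) T,
      ε ^ 2 * deriv (deriv u₂) t = u₂ t ^ 3 - lam * u₂ t + Real.cos t)
    (hi₁ : u₁ 0 = α₁) (hi₂ : u₂ 0 = α₂)
    (hd₁ : deriv u₁ 0 = 0) (hd₂ : deriv u₂ 0 = 0)
    (hneg : ∀ t ∈ Icc (0 : ℝ) T, u₂ t ≤ 0) :
    ∀ t ∈ Icc (0 : ℝ) T, u₁ t < u₂ t := by
  have h₁ (t) : HasDerivAt u₁ (deriv u₁ t) t := (hu₁.differentiable (by norm_num) t).hasDerivAt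
  have h₂ (t) : HasDerivAt u₂ (deriv u₂ t) t := (hu₂.differentiable (by norm_num) t).hasDerivAt
  have h₁' (t) : HasDerivAt (deriv u₁) (deriv (deriv u₁) t) t :=
    (hu₁.differentiable_deriv_two t).hasDerivAt
  have h₂' (t) : HasDerivAt (deriv u₂) (deriv (deriv u₂) t) t :=
    (hu₂.differentiable_deriv_two t).hasDerivAt
  intro r hr
  by_contra! hlt
  obtain ⟨s, ⟨hs0, hsT⟩, hds, hpos⟩ := ContinuousOn.exists_first_zero
    (d := fun t => u₂ t - u₁ t) (hu₂.continuous.sub hu₁.continuous).continuousOn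
    (by simp only [hi₁, hi₂]; linarith) hr (by linarith)
  have hderiv : deriv u₂ s - deriv u₁ s ≤ 0 :=
    ((h₂ s).sub (h₁ s)).nonpos_of_nonneg_left hs0 hds fun t ht => (hpos t ⟨ht.1.le, ht.2⟩).le
  have hW (t) : HasDerivAt (fun t => deriv u₁ t * u₂ t - u₁ t * deriv u₂ t)
      (deriv (deriv u₁) t * u₂ t - u₁ t * deriv (deriv u₂) t) t :=
    (((h₁' t).mul (h₂ t)).sub ((h₁ t).mul (h₂' t))).congr_deriv (by ring)
  have hmono : StrictMonoOn (fun t => deriv u₁ t * u₂ t - u₁ t * deriv u₂ t) (Icc 0 s) := by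
    refine strictMonoOn_of_deriv_pos (convex_Icc 0 s)
      (fun t _ => (hW t).continuousAt.continuousWithinAt) fun t ht => ?_
    rw [interior_Icc] at ht
    rw [(hW t).deriv]
    have htT : t ∈ Icc 0 T := ⟨ht.1.le, ht.2.le.trans hsT⟩
    have hd : 0 < u₂ t - u₁ t := hpos t ⟨ht.1.le, ht.2⟩
    have hu : u₂ t ≤ 0 := hneg t htT
    have hcos : 0 < Real.cos t :=
      Real.cos_pos_of_mem_Ioo ⟨by linarith [ht.1, Real.pi_pos], by linarith [ht.2]⟩
    have hprod : 0 ≤ u₁ t * u₂ t := mul_nonneg_of_nonpos_of_nonpos (by linarith) hu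
    have hsum : 0 ≤ -(u₁ t + u₂ t) := by linarith
    have key : ε ^ 2 * (deriv (deriv u₁) t * u₂ t - u₁ t * deriv (deriv u₂) t) =
        u₁ t * u₂ t * (-(u₁ t + u₂ t)) * (u₂ t - u₁ t) + Real.cos t * (u₂ t - u₁ t) := by
      linear_combination u₂ t * heq₁ t htT - u₁ t * heq₂ t htT
    refine pos_of_mul_pos_right (a := ε ^ 2) ?_ (by positivity)
    rw [key]
    positivity
  have hWs := hmono (left_mem_Icc.2 hs0.le) (right_mem_Icc.2 hs0.le) hs0
  have hus : u₁ s = u₂ s := by linarith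
  simp only [hd₁, hd₂, hus] at hWs
  nlinarith [hneg s ⟨hs0.le, hsT⟩]
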